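/- arXiv:2108.06724 — 2 statements merged into one kernel-verified Lean document; each statement's English description precedes it below -/
import Mathlib

section
/- Let f : G → G be a graph map and x ∈ G such that ω_f(x) is a solenoid. If Y is a cycle of graphs with Y ∩ ω_f(x) ≠ ∅, then ω_f(x) ⊆ Y, and for every n ∈ ℕ there exists a cycle of graphs X with period at least n such that ω_f(x) ⊆ X ⊆ Y. -/
open Set Filter Topology

/-- An arc in `X` with endpoints `a` and `b`: the image of a continuous injection
of `[0,1]` sending `0` to `a` and `1` to `b`. -/
def IsArcWithEnds {X : Type*} [TopologicalSpace X] (A : Set X) (a b : X) : Prop :=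
  ∃ φ : Set.Icc (0:ℝ) 1 → X, Continuous φ ∧ Function.Injective φ ∧
    Set.range φ = A ∧ φ ⟨0, by norm_num⟩ = a ∧ φ ⟨1, by norm_num⟩ = b

/-- A topological graph: a compact connected (metrizable) space which is a union of
finitely many arcs, any two of which are either disjoint or intersect in exactly one
common endpoint. -/
def IsTopGraph (X : Type*) [TopologicalSpace X] : Prop :=
  CompactSpace X ∧ ConnectedSpace X ∧
  ∃ (n : ℕ) (A : Fin n → Set X) (a b : Fin n → X),
    (∀ i, IsArcWithEnds (A i) (a i) (b i)) ∧
    (⋃ i, A i) = Set.univ ∧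
    ∀ i j, i ≠ j →
      A i ∩ A j = ∅ ∨
      ∃ p, A i ∩ A j = {p} ∧ p ∈ ({a i, b i} : Set X) ∧ p ∈ ({a j, b j} : Set X)

/-- A subgraph of `G`: a closed connected subset which is itself a topological graph. -/
def IsSubgraph {G : Type*} [TopologicalSpace G] (K : Set G) : Prop :=
  IsClosed K ∧ IsConnected K ∧ IsTopGraph ↥K

/-- A periodic subgraph with period `k`: `K, f(K), …, f^{k−1}(K)` are pairwise disjoint
and `f^k(K) = K`. -/
def IsPeriodicSubgraph {G : Type*} [TopologicalSpace G] (f : G → G) (K : Set G) (k : ℕ) :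
    Prop :=
  IsSubgraph K ∧ 0 < k ∧ f^[k] '' K = K ∧
    ∀ i j, i < k → j < k → i ≠ j → Disjoint (f^[i] '' K) (f^[j] '' K)

/-- A cycle of graphs with period `k`: the orbit `⋃_{i<k} f^i(K)` of a periodic
subgraph `K` with period `k`. -/
def IsCycleOfGraphs {G : Type*} [TopologicalSpace G] (f : G → G) (X : Set G) (k : ℕ) :
    Prop :=
  ∃ K, IsPeriodicSubgraph f K k ∧ X = ⋃ i ∈ Finset.range k, f^[i] '' K

/-- The ω-limit set of `x` under `f`. -/
def omegaSet {G : Type*} [TopologicalSpace G] (f : G → G) (x : G) : Set G :=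
  ⋂ n : ℕ, closure ((fun m => f^[m] x) '' Set.Ici n)

/-- `ω(f) = ⋃_{x} ω_f(x)`. -/
def omegaUnion {G : Type*} [TopologicalSpace G] (f : G → G) : Set G :=
  ⋃ x, omegaSet f x

/-- A set `W` is a solenoid for `f` if it is infinite and is contained in cycles of
graphs of arbitrarily large periods. -/
def IsSolenoid {G : Type*} [TopologicalSpace G] (f : G → G) (W : Set G) : Prop :=
  W.Infinite ∧ ∀ n : ℕ, ∃ X k, n ≤ k ∧ IsCycleOfGraphs f X k ∧ W ⊆ X

/-- Two points are separable if they belong to two disjoint periodic subgraphs. -/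
def SeparablePoints {G : Type*} [TopologicalSpace G] (f : G → G) (x y : G) : Prop :=
  ∃ I J kI kJ, IsPeriodicSubgraph f I kI ∧ IsPeriodicSubgraph f J kJ ∧
    Disjoint I J ∧ x ∈ I ∧ y ∈ J

/-- An NS-pair: a pair of distinct points of `ω(f)` contained in a nested sequence of
periodic subgraphs whose periods tend to infinity. -/
def IsNSPair {G : Type*} [TopologicalSpace G] (f : G → G) (x y : G) : Prop :=
  x ≠ y ∧ x ∈ omegaUnion f ∧ y ∈ omegaUnion f ∧
  ∃ (J : ℕ → Set G) (m : ℕ → ℕ),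
    (∀ n, IsPeriodicSubgraph f (J n) (m n)) ∧
    (∀ n, J (n + 1) ⊆ J n) ∧
    Filter.Tendsto m Filter.atTop Filter.atTop ∧
    ∀ n, x ∈ J n ∧ y ∈ J n

/-- The pair `⟨x,y⟩` is proximal. -/
def Proximal {G : Type*} [PseudoMetricSpace G] (f : G → G) (x y : G) : Prop :=
  ∀ ε > (0 : ℝ), ∀ N : ℕ, ∃ n ≥ N, dist (f^[n] x) (f^[n] y) < ε

/-- The pair `⟨x,y⟩` is asymptotic. -/
def Asymptotic {G : Type*} [PseudoMetricSpace G] (f : G → G) (x y : G) : Prop :=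
  Filter.Tendsto (fun n => dist (f^[n] x) (f^[n] y)) Filter.atTop (nhds 0)

/-- A scrambled pair is proximal but not asymptotic. -/
def ScrambledPair {G : Type*} [PseudoMetricSpace G] (f : G → G) (x y : G) : Prop :=
  Proximal f x y ∧ ¬ Asymptotic f x y

/-- Li–Yorke chaos: existence of an uncountable scrambled set. -/
def LiYorkeChaotic {G : Type*} [PseudoMetricSpace G] (f : G → G) : Prop :=
  ∃ S : Set G, ¬ S.Countable ∧ ∀ x ∈ S, ∀ y ∈ S, x ≠ y → ScrambledPair f x y

/-- `I ⊆ ℕ` is an independence set for the pair of sets `{A, B}`. -/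
def IsIndepSet {G : Type*} (f : G → G) (A B : Set G) (I : Set ℕ) : Prop :=
  ∀ J : Finset ℕ, ↑J ⊆ I → J.Nonempty → ∀ S : ℕ → Bool,
    (⋂ i ∈ J, f^[i] ⁻¹' (if S i then A else B)).Nonempty

/-- An IN-pair: every pair of neighborhoods has arbitrarily large finite
independence sets. -/
def IsINPair {G : Type*} [TopologicalSpace G] (f : G → G) (x y : G) : Prop :=
  ∀ U V : Set G, U ∈ nhds x → V ∈ nhds y →
    ∀ n : ℕ, ∃ I : Finset ℕ, n ≤ I.card ∧ IsIndepSet f U V ↑I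

/-- An IT-pair: every pair of neighborhoods has an infinite independence set. -/
def IsITPair {G : Type*} [TopologicalSpace G] (f : G → G) (x y : G) : Prop :=
  ∀ U V : Set G, U ∈ nhds x → V ∈ nhds y →
    ∃ I : Set ℕ, I.Infinite ∧ IsIndepSet f U V I

/-- The set of periodic points of `f`. -/
def PerPts {G : Type*} (f : G → G) : Set G :=
  {p | ∃ n ≥ 1, f^[n] p = p}

/-- The image of an open subinterval under a parametrization of an arc of the graph is open in
the graph, provided the other sets `B` of the decomposition meet the arc only in its endpoints. -/
lemma isOpen_image_Ioo_of_arc {X : Type*} [TopologicalSpace X] [T2Space X]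
    {φ : Set.Icc (0:ℝ) 1 → X} (hφ : Continuous φ) (hinj : Function.Injective φ)
    {B : Set X} (hB : IsClosed B) (hcover : Set.range φ ∪ B = Set.univ)
    (hint : ∀ p ∈ Set.range φ ∩ B, p = φ 0 ∨ p = φ 1) (s t : Set.Icc (0:ℝ) 1) :
    IsOpen (φ '' Set.Ioo s t) := by
  have hcompl : (φ '' Set.Ioo s t)ᶜ = φ '' (Set.Ioo s t)ᶜ ∪ B := by
    ext p
    simp only [mem_compl_iff, mem_union]
    constructor
    · intro hp
      rcases (hcover ▸ mem_univ p : p ∈ Set.range φ ∪ B) with ⟨u, rfl⟩ | h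
      · exact Or.inl ⟨u, fun hu => hp ⟨u, hu, rfl⟩, rfl⟩
      · exact Or.inr h
    · rintro (⟨u, hu, rfl⟩ | h) ⟨v, hv, hvp⟩
      · exact hu (hinj hvp ▸ hv)
      · rcases hint p ⟨⟨v, hvp⟩, h⟩ with h0 | h1
        · have : v = 0 := hinj (hvp.trans h0)
          subst this
          exact absurd hv.1 (not_lt.mpr s.2.1)
        · have : v = 1 := hinj (hvp.trans h1)
          subst this
          exact absurd hv.2 (not_lt.mpr t.2.2)
  rw [← isClosed_compl_iff, hcompl]
  exact (hφ.isClosedMap _ isOpen_Ioo.isClosed_compl).union hB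

/-- If all open subintervals of an arc are open in the ambient space, then a closed connected set
has only finitely many frontier points on the arc. -/
lemma finite_preimage_frontier_of_isPreconnected {X : Type*} [TopologicalSpace X] [T2Space X]
    {φ : Set.Icc (0:ℝ) 1 → X} (hφ : Continuous φ) (hinj : Function.Injective φ)
    (hopen : ∀ s t, IsOpen (φ '' Set.Ioo s t)) {K : Set X} (hK : IsClosed K)
    (hconn : IsPreconnected K) : (φ ⁻¹' frontier K).Finite := by
  by_contra hinf
  obtain ⟨F, hF, hcard⟩ := Set.Infinite.exists_subset_card_eq hinf 5
  let p := F.orderEmbOfFin hcard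
  have hp : ∀ i, φ (p i) ∈ frontier K := fun i => hF (F.orderEmbOfFin_mem hcard i)
  have hlt : ∀ i j, i < j → p i < p j := fun i j h => p.strictMono h
  have hgap : ∀ i j l, i < j → j < l → ∃ u, p i < u ∧ u < p l ∧ φ u ∉ K := by
    intro i j l hij hjl
    have hcl : φ (p j) ∈ closure Kᶜ := frontier_compl K ▸ hp j |> frontier_subset_closure
    obtain ⟨_, ⟨u, hu, rfl⟩, huK⟩ := mem_closure_iff.mp hcl _ (hopen (p i) (p l))
      ⟨p j, ⟨hlt _ _ hij, hlt _ _ hjl⟩, rfl⟩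
    exact ⟨u, hu.1, hu.2, huK⟩
  obtain ⟨u, hu, hu', huK⟩ := hgap 0 1 2 (by decide) (by decide)
  obtain ⟨v, hv, hv', hvK⟩ := hgap 2 3 4 (by decide) (by decide)
  have hmem : ∀ i, φ (p i) ∈ K := fun i => hK.frontier_subset (hp i)
  have hsub : K ⊆ φ '' Set.Ioo u v ∪ (φ '' Set.Icc u v)ᶜ := by
    intro z hz
    by_cases h : z ∈ φ '' Set.Icc u v
    · obtain ⟨w, hw, rfl⟩ := h
      refine Or.inl ⟨w, ⟨lt_of_le_of_ne hw.1 ?_, lt_of_le_of_ne hw.2 ?_⟩, rfl⟩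
      · rintro rfl; exact huK hz
      · rintro rfl; exact hvK hz
    · exact Or.inr h
  have hleft : φ (p 0) ∉ φ '' Set.Icc u v := by
    rintro ⟨w, hw, hwp⟩
    exact absurd (hinj hwp ▸ hw.1) (not_le.mpr hu)
  obtain ⟨z, -, ⟨w, hw, rfl⟩, hz⟩ := hconn _ _ (hopen u v)
    (hφ.isClosedMap _ isClosed_Icc).isOpen_compl hsub
    ⟨φ (p 2), hmem 2, p 2, ⟨hu', hv⟩, rfl⟩ ⟨φ (p 0), hmem 0, hleft⟩
  exact hz ⟨w, Ioo_subset_Icc_self hw, rfl⟩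

/-- A closed connected subset of a topological graph has finite frontier. -/
lemma IsTopGraph.finite_frontier {G : Type*} [TopologicalSpace G] [T2Space G] (hG : IsTopGraph G)
    {K : Set G} (hK : IsClosed K) (hconn : IsPreconnected K) : (frontier K).Finite := by
  obtain ⟨-, -, n, A, a, b, harc, hcover, hint⟩ := hG
  have hclosed : ∀ i, IsClosed (A i) := by
    intro i
    obtain ⟨φ, hφ, -, hr, -⟩ := harc i
    exact hr ▸ (isCompact_range hφ).isClosed
  have hfin : ∀ i, (A i ∩ frontier K).Finite := by
    intro i
    obtain ⟨φ, hφ, hinj, hr, ha, hb⟩ := harc i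
    have hB : IsClosed (⋃ j ∈ {j | j ≠ i}, A j) :=
      (Set.toFinite _).isClosed_biUnion fun j _ => hclosed j
    have hcov : Set.range φ ∪ (⋃ j ∈ {j | j ≠ i}, A j) = Set.univ := by
      refine eq_univ_of_forall fun p => ?_
      obtain ⟨j, hj⟩ := mem_iUnion.mp (hcover ▸ mem_univ p : p ∈ ⋃ j, A j)
      by_cases h : j = i
      · subst h
        exact Or.inl (hr ▸ hj)
      · exact Or.inr (mem_biUnion h hj)
    have hends : ∀ p ∈ Set.range φ ∩ (⋃ j ∈ {j | j ≠ i}, A j), p = φ 0 ∨ p = φ 1 := by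
      rintro p ⟨hpi, hp⟩
      obtain ⟨j, hj, hpj⟩ := mem_iUnion₂.mp hp
      have hpij : p ∈ A i ∩ A j := ⟨hr ▸ hpi, hpj⟩
      rcases hint i j (Ne.symm hj) with h | ⟨q, hq, hqi, -⟩
      · exact absurd hpij (h ▸ notMem_empty p)
      · obtain rfl : p = q := by rwa [hq] at hpij
        rw [← ha, ← hb] at hqi
        exact hqi
    rw [← hr, ← image_preimage_eq_range_inter]
    exact (finite_preimage_frontier_of_isPreconnected hφ hinj
      (isOpen_image_Ioo_of_arc hφ hinj hB hcov hends) hK hconn).image φ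
  refine (Set.finite_iUnion hfin).subset fun p hp => ?_
  obtain ⟨j, hj⟩ := mem_iUnion.mp (hcover ▸ mem_univ p : p ∈ ⋃ j, A j)
  exact mem_iUnion.mpr ⟨j, hj, hp⟩

lemma finite_frontier_biUnion {X ι : Type*} [TopologicalSpace X] (s : Finset ι) (C : ι → Set X)
    (hC : ∀ i ∈ s, (frontier (C i)).Finite) : (frontier (⋃ i ∈ s, C i)).Finite := by
  classical
  induction s using Finset.induction_on with
  | empty => simp
  | insert i s _ ih =>
    rw [Finset.set_biUnion_insert]
    refine Set.Finite.subset ((hC i (Finset.mem_insert_self i s)).union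
      (ih fun j hj => hC j (Finset.mem_insert_of_mem hj))) ?_
    exact (frontier_union_subset _ _).trans
      (union_subset_union inter_subset_left inter_subset_right)

section Cycle

variable {G : Type*} [TopologicalSpace G] {f : G → G} {X Y : Set G} {k : ℕ}

lemma IsCycleOfGraphs.mapsTo (hY : IsCycleOfGraphs f Y k) : MapsTo f Y Y := by
  obtain ⟨K, ⟨-, hk, hper, -⟩, rfl⟩ := hY
  intro y hy
  obtain ⟨i, hi, z, hz, rfl⟩ := mem_iUnion₂.mp hy
  rw [Finset.mem_range] at hi
  rw [← Function.iterate_succ_apply' f i z]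
  by_cases h : i + 1 < k
  · exact mem_biUnion (Finset.mem_coe.mpr (Finset.mem_range.mpr h)) ⟨z, hz, rfl⟩
  · obtain rfl : i + 1 = k := by omega
    refine mem_biUnion (Finset.mem_coe.mpr (Finset.mem_range.mpr hk)) ?_
    have : f^[i + 1] z ∈ K := hper ▸ mem_image_of_mem _ hz
    simpa using this

lemma IsCycleOfGraphs.finite_frontier [T2Space G] (hG : IsTopGraph G) (hf : Continuous f)
    (hY : IsCycleOfGraphs f Y k) : (frontier Y).Finite := by
  obtain ⟨K, ⟨⟨hcl, hconn, -⟩, -⟩, rfl⟩ := hY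
  have : CompactSpace G := hG.1
  exact finite_frontier_biUnion _ _ fun i _ => hG.finite_frontier
    ((hf.iterate i).isClosedMap _ hcl)
    (hconn.isPreconnected.image _ (hf.iterate i).continuousOn)

/-- A cycle of graphs that meets a forward invariant set `Y` with fewer frontier points than the
period of the cycle is contained in `Y`. -/
lemma IsCycleOfGraphs.subset_of_ncard_frontier_lt (hf : Continuous f)
    (hX : IsCycleOfGraphs f X k) (hY : MapsTo f Y Y) (hfin : (frontier Y).Finite)
    (hlt : (frontier Y).ncard < k) (hmeet : (X ∩ Y).Nonempty) : X ⊆ Y := by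
  obtain ⟨K, ⟨⟨-, hconn, -⟩, -, hper, hdisj⟩, rfl⟩ := hX
  obtain ⟨y, hyX, hyY⟩ := hmeet
  obtain ⟨r, hr, z, hz, rfl⟩ := mem_iUnion₂.mp hyX
  rw [Finset.mem_range] at hr
  have hzK : f^[k] z ∈ K := hper ▸ mem_image_of_mem _ hz
  have hzY : f^[k] z ∈ Y := by
    have := hY.iterate (k - r) hyY
    rwa [← Function.iterate_add_apply, Nat.sub_add_cancel hr.le] at this
  obtain ⟨i, hi, hempty⟩ : ∃ i < k, ¬ (f^[i] '' K ∩ frontier Y).Nonempty := by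
    by_contra! hall
    have : Nonempty G := ⟨z⟩
    choose! g hg using hall
    have hcard : (Finset.range k : Set ℕ).ncard ≤ (frontier Y).ncard := by
      refine Set.ncard_le_ncard_of_injOn g (fun i hi => (hg i (by simpa using hi)).2) ?_ hfin
      intro i hi j hj hij
      by_contra hne
      have hi' : i < k := by simpa using hi
      have hj' : j < k := by simpa using hj
      exact Set.disjoint_left.mp (hdisj i j hi' hj' hne) (hg i hi').1 (hij ▸ (hg j hj').1)
    rw [Set.ncard_coe_finset, Finset.card_range] at hcard
    omega
  have hiY : f^[i] '' K ⊆ Y := by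
    have hint : ∀ w ∈ f^[i] '' K, w ∈ closure Y → w ∈ interior Y := by
      intro w hw hwY
      by_contra h
      exact hempty ⟨w, hw, hwY, h⟩
    have himg : IsPreconnected (f^[i] '' K) :=
      hconn.isPreconnected.image _ (hf.iterate i).continuousOn
    have hmem : f^[i] (f^[k] z) ∈ f^[i] '' K := mem_image_of_mem _ hzK
    refine (himg.subset_of_closure_inter_subset isOpen_interior
      ⟨_, hmem, hint _ hmem (subset_closure (hY.iterate i hzY))⟩ ?_).trans interior_subset
    exact fun w hw => hint w hw.2 (closure_mono interior_subset hw.1)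
  have hKY : K ⊆ Y := by
    intro w hw
    rw [← hper] at hw
    obtain ⟨v, hv, rfl⟩ := hw
    have := hY.iterate (k - i) (hiY (mem_image_of_mem _ hv))
    rwa [← Function.iterate_add_apply, Nat.sub_add_cancel hi.le] at this
  refine iUnion₂_subset fun j _ => ?_
  rintro _ ⟨w, hw, rfl⟩
  exact hY.iterate j (hKY hw)

end Cycle

/-- If `ω_f(x)` is a solenoid and `Y` is a cycle of graphs meeting `ω_f(x)`, then
`ω_f(x) ⊆ Y` and for every `n` there is a cycle of graphs `X` with period at least `n`
such that `ω_f(x) ⊆ X ⊆ Y`. -/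
theorem omegaSet_subset_of_cycle_inter_nonempty {G : Type*} [MetricSpace G]
    (hG : IsTopGraph G) (f : G → G) (hf : Continuous f) (x : G)
    (hsol : IsSolenoid f (omegaSet f x))
    (Y : Set G) (k : ℕ) (hY : IsCycleOfGraphs f Y k)
    (hmeet : (Y ∩ omegaSet f x).Nonempty) :
    omegaSet f x ⊆ Y ∧
      ∀ n : ℕ, ∃ (X : Set G) (m : ℕ), n ≤ m ∧ IsCycleOfGraphs f X m ∧
        omegaSet f x ⊆ X ∧ X ⊆ Y := by
  have hfin := hY.finite_frontier hG hf
  have hlarge : ∀ n : ℕ, ∃ (X : Set G) (m : ℕ), n ≤ m ∧ IsCycleOfGraphs f X m ∧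
      omegaSet f x ⊆ X ∧ X ⊆ Y := by
    intro n
    obtain ⟨X, m, hm, hX, hsub⟩ := hsol.2 (max n ((frontier Y).ncard + 1))
    obtain ⟨y, hyY, hyW⟩ := hmeet
    exact ⟨X, m, (le_max_left _ _).trans hm, hX, hsub,
      hX.subset_of_ncard_frontier_lt hf hY.mapsTo hfin ((le_max_right _ _).trans hm)
        ⟨y, hsub hyW, hyY⟩⟩
  obtain ⟨X, -, -, -, hsub, hXY⟩ := hlarge 0
  exact ⟨hsub.trans hXY, hlarge⟩
end

section
/- Let f : G → G be a graph map and let (X_n) be a sequence of cycles of graphs with periods (k_n) such that X_{n+1} ⊆ X_n for all n and k_n → ∞. Then there exists z ∈ G with ω_f(z) ⊆ ⋂_{n≥1} X_n such that for every x ∈ G with ω_f(x) ∩ ⋂_{n≥1} X_n ≠ ∅ one has ω_f(x) ⊆ ω_f(z); in particular ω_f(z) is the unique maximal ω-limit set contained in ⋂_{n≥1} X_n. -/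
open Set Filter Topology

section Frontier

theorem IsPreconnected.inter_frontier_nonempty_of_not_subset {Y : Type*} [TopologicalSpace Y]
    {B C : Set Y} (hB : IsPreconnected B) (hne : (B ∩ C).Nonempty) (hsub : ¬ B ⊆ C) :
    (B ∩ frontier C).Nonempty := by
  by_contra h
  rw [not_nonempty_iff_eq_empty] at h
  have hcover : B ⊆ interior C ∪ (closure C)ᶜ := by
    intro x hx
    by_contra hx'
    simp only [mem_union, mem_compl_iff, not_or, not_not] at hx'
    have : x ∈ B ∩ frontier C := ⟨hx, hx'.2, hx'.1⟩
    simp [h] at this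
  have hdisj : Disjoint (interior C) (closure C)ᶜ :=
    disjoint_compl_right.mono_left (interior_subset.trans subset_closure)
  obtain ⟨x, hxB, hxC⟩ := hne
  have hxi : x ∈ interior C := (hcover hxB).resolve_right fun hx => hx (subset_closure hxC)
  exact hsub ((hB.subset_left_of_subset_union isOpen_interior isClosed_closure.isOpen_compl
    hdisj hcover ⟨x, hxB, hxi⟩).trans interior_subset)

variable {Y I : Type*} [TopologicalSpace Y] [LinearOrder I]

theorem IsPreconnected.subset_image_Ioo {C : Set Y} (hC : IsPreconnected C) {φ : I → Y}
    {s t p : I} (ho : IsOpen (φ '' Ioo s t)) (hc : IsClosed (φ '' Icc s t))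
    (hs : φ s ∉ C) (ht : φ t ∉ C) (hp : p ∈ Ioo s t) (hpC : φ p ∈ C) :
    C ⊆ φ '' Ioo s t := by
  refine hC.subset_left_of_subset_union ho hc.isOpen_compl
    (disjoint_compl_right.mono_left (image_mono Ioo_subset_Icc_self)) ?_
    ⟨φ p, hpC, p, hp, rfl⟩
  intro x hx
  by_cases hxI : x ∈ φ '' Icc s t
  · obtain ⟨u, ⟨hu1, hu2⟩, rfl⟩ := hxI
    refine Or.inl ⟨u, ⟨lt_of_le_of_ne hu1 ?_, lt_of_le_of_ne hu2 ?_⟩, rfl⟩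
    · rintro rfl; exact hs hx
    · rintro rfl; exact ht hx
  · exact Or.inr hxI

theorem exists_mem_not_mem_of_mem_frontier_image {C : Set Y} {φ : I → Y} {s t u : I}
    (ho : IsOpen (φ '' Ioo s t)) (hu : u ∈ Ioo s t) (hC : φ u ∈ frontier C) :
    (∃ p ∈ Ioo s t, φ p ∈ C) ∧ ∃ q ∈ Ioo s t, φ q ∉ C := by
  rw [frontier_eq_closure_inter_closure] at hC
  obtain ⟨_, ⟨p, hp, rfl⟩, hpC⟩ := mem_closure_iff.1 hC.1 _ ho ⟨u, hu, rfl⟩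
  obtain ⟨_, ⟨q, hq, rfl⟩, hqC⟩ := mem_closure_iff.1 hC.2 _ ho ⟨u, hu, rfl⟩
  exact ⟨⟨p, hp, hpC⟩, q, hq, hqC⟩

/-- A connected set has at most two frontier points in the interior of an edge. -/
theorem IsPreconnected.not_three_mem_frontier_edge [DenselyOrdered I] {C : Set Y}
    (hC : IsPreconnected C) {φ : I → Y} (hφ : Function.Injective φ)
    (ho : ∀ s t, IsOpen (φ '' Ioo s t)) (hc : ∀ s t, IsClosed (φ '' Icc s t))
    {a b t₁ t₂ t₃ : I} (ha : a < t₁) (h₁₂ : t₁ < t₂) (h₂₃ : t₂ < t₃) (hb : t₃ < b)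
    (h₁ : φ t₁ ∈ frontier C) (h₂ : φ t₂ ∈ frontier C) (h₃ : φ t₃ ∈ frontier C) : False := by
  obtain ⟨m, hm₁, hm₂⟩ := exists_between h₁₂
  obtain ⟨m', hm₁', hm₂'⟩ := exists_between h₂₃
  obtain ⟨⟨p₁, hp₁, hpC₁⟩, q₁, hq₁, hqC₁⟩ :=
    exists_mem_not_mem_of_mem_frontier_image (ho a m) ⟨ha, hm₁⟩ h₁
  obtain ⟨⟨p₂, hp₂, hpC₂⟩, q₂, hq₂, hqC₂⟩ :=
    exists_mem_not_mem_of_mem_frontier_image (ho m m') ⟨hm₂, hm₁'⟩ h₂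
  obtain ⟨⟨p₃, hp₃, hpC₃⟩, q₃, hq₃, hqC₃⟩ :=
    exists_mem_not_mem_of_mem_frontier_image (ho m' b) ⟨hm₂', hb⟩ h₃
  rcases lt_trichotomy q₂ p₂ with h | h | h
  · obtain ⟨u, hu, huφ⟩ := hC.subset_image_Ioo (ho q₂ q₃) (hc q₂ q₃) hqC₂ hqC₃
      ⟨h, hp₂.2.trans hq₃.1⟩ hpC₂ hpC₁
    rw [hφ huφ] at hu
    exact lt_asymm hu.1 (hp₁.2.trans hq₂.1)
  · exact hqC₂ (h ▸ hpC₂)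
  · obtain ⟨u, hu, huφ⟩ := hC.subset_image_Ioo (ho q₁ q₂) (hc q₁ q₂) hqC₁ hqC₂
      ⟨hq₁.2.trans hp₂.1, h⟩ hpC₂ hpC₃
    rw [hφ huφ] at hu
    exact lt_asymm hu.2 (hq₂.2.trans hp₃.1)

end Frontier

/-- In a topological graph, the number of frontier points of connected subsets is
uniformly bounded. -/
theorem IsTopGraph.exists_encard_frontier_le {Y : Type*} [TopologicalSpace Y] [T2Space Y]
    (hY : IsTopGraph Y) :
    ∃ R : ℕ, ∀ C : Set Y, IsPreconnected C → (frontier C).encard ≤ R := by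
  obtain ⟨-, -, n, A, a, b, hA, hcov, hint⟩ := hY
  choose φ hφc hφi hφr hφ0 hφ1 using hA
  have hclosed : ∀ i (S : Set (Icc (0 : ℝ) 1)), IsClosed S → IsClosed (φ i '' S) :=
    fun i S hS => (hS.isCompact.image (hφc i)).isClosed
  have hopen : ∀ i s t, IsOpen (φ i '' Ioo s t) := by
    intro i s t
    have hcompl : (φ i '' Ioo s t)ᶜ =
        (⋃ j : {j // j ≠ i}, A j) ∪ (φ i '' Iic s ∪ φ i '' Ici t) := by
      ext x
      constructor
      · intro hx
        obtain ⟨j, hj⟩ := mem_iUnion.1 (hcov ▸ mem_univ x : x ∈ ⋃ i, A i)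
        by_cases hji : j = i
        · subst hji
          rw [← hφr] at hj
          obtain ⟨u, rfl⟩ := hj
          right
          rcases le_or_gt u s with h | h
          · exact Or.inl ⟨u, h, rfl⟩
          rcases le_or_gt t u with h' | h'
          · exact Or.inr ⟨u, h', rfl⟩
          exact absurd ⟨u, ⟨h, h'⟩, rfl⟩ hx
        · exact Or.inl (mem_iUnion.2 ⟨⟨j, hji⟩, hj⟩)
      · rintro hx ⟨u, hu, rfl⟩
        rcases hx with hx | ⟨v, hv, hvu⟩ | ⟨v, hv, hvu⟩
        · obtain ⟨⟨j, hji⟩, hj⟩ := mem_iUnion.1 hx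
          have hmem : φ i u ∈ A i ∩ A j := ⟨hφr i ▸ mem_range_self u, hj⟩
          rcases hint i j (Ne.symm hji) with h | ⟨p, hp, hpi, -⟩
          · simp [h] at hmem
          · rw [hp, mem_singleton_iff] at hmem
            rw [← hmem, ← hφ0, ← hφ1] at hpi
            rcases hpi with h | h
            · exact not_lt_of_ge (show (⟨0, by norm_num⟩ : Icc (0 : ℝ) 1) ≤ s from s.2.1)
                (hφi i h ▸ hu.1)
            · exact not_lt_of_ge (show t ≤ (⟨1, by norm_num⟩ : Icc (0 : ℝ) 1) from t.2.2)
                (hφi i h ▸ hu.2)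
        · rw [hφi i hvu] at hv
          exact not_lt_of_ge hv hu.1
        · rw [hφi i hvu] at hv
          exact not_lt_of_ge hv hu.2
    rw [← isClosed_compl_iff, hcompl]
    refine (isClosed_iUnion_of_finite fun j => ?_).union
      ((hclosed i _ isClosed_Iic).union (hclosed i _ isClosed_Ici))
    rw [← hφr, ← image_univ]
    exact hclosed _ _ isClosed_univ
  refine ⟨n * 4, fun C hC => ?_⟩
  have hsub : frontier C ⊆
      ⋃ i, ({φ i 0, φ i 1} ∪ φ i '' {t | t ∈ Ioo 0 1 ∧ φ i t ∈ frontier C}) := by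
    intro x hx
    obtain ⟨i, hi⟩ := mem_iUnion.1 (hcov ▸ mem_univ x : x ∈ ⋃ i, A i)
    rw [← hφr] at hi
    obtain ⟨u, rfl⟩ := hi
    refine mem_iUnion.2 ⟨i, ?_⟩
    by_cases h0 : u = 0
    · simp [h0]
    by_cases h1 : u = 1
    · simp [h1]
    exact Or.inr ⟨u, ⟨⟨unitInterval.pos_iff_ne_zero.2 h0, unitInterval.lt_one_iff_ne_one.2 h1⟩,
      hx⟩, rfl⟩
  have hedge : ∀ i, {t : Icc (0 : ℝ) 1 | t ∈ Ioo 0 1 ∧ φ i t ∈ frontier C}.encard ≤ 2 := by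
    intro i
    by_contra! h
    obtain ⟨T, hT, hT3⟩ := exists_subset_encard_eq (Order.add_one_le_of_lt h)
    have hTf : T.Finite := finite_of_encard_eq_coe (k := 3) (hT3.trans (by norm_num))
    have hcard : hTf.toFinset.card = 3 := by
      have := hTf.encard_eq_coe_toFinset_card
      rw [hT3] at this
      exact_mod_cast this.symm
    let g := hTf.toFinset.orderEmbOfFin hcard
    have hg : ∀ j, g j ∈ Ioo 0 1 ∧ φ i (g j) ∈ frontier C := fun j =>
      hT (hTf.mem_toFinset.1 (hTf.toFinset.orderEmbOfFin_mem hcard j))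
    exact hC.not_three_mem_frontier_edge (hφi i) (hopen i) (fun s t => hclosed i _ isClosed_Icc)
      (hg 0).1.1 (g.strictMono (by decide : (0 : Fin 3) < 1))
      (g.strictMono (by decide : (1 : Fin 3) < 2)) (hg 2).1.2 (hg 0).2 (hg 1).2 (hg 2).2
  calc (frontier C).encard
      ≤ _ := encard_le_encard hsub
    _ ≤ _ := encard_iUnion_le_of_fintype _
    _ ≤ ∑ _i : Fin n, (4 : ℕ∞) := by
        refine Finset.sum_le_sum fun i _ => (encard_union_le _ _).trans ?_
        calc _ ≤ (2 : ℕ∞) + 2 := add_le_add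
                ((encard_insert_le _ _).trans (by rw [encard_singleton]; norm_num))
                ((encard_image_le _ _).trans (hedge i))
          _ = 4 := by norm_num
    _ = (n * 4 : ℕ) := by simp

/-- A connected set meeting many pairwise disjoint connected sets contains one of them. -/
theorem exists_subset_of_encard_frontier_le {Y : Type*} [TopologicalSpace Y] {C : Set Y} {R : ℕ}
    (hR : (frontier C).encard ≤ R) (B : Fin (R + 1) → Set Y)
    (hB : ∀ i, IsPreconnected (B i)) (hdisj : ∀ i j, i ≠ j → Disjoint (B i) (B j))
    (hmeet : ∀ i, (B i ∩ C).Nonempty) : ∃ i, B i ⊆ C := by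
  by_contra! h
  choose p hp using fun i => (hB i).inter_frontier_nonempty_of_not_subset (hmeet i) (h i)
  have hinj : Function.Injective p := fun i j hij => by
    by_contra hne
    exact disjoint_left.1 (hdisj i j hne) (hp i).1 (hij ▸ (hp j).1)
  have h1 : (range p).encard ≤ R :=
    (encard_le_encard (range_subset_iff.2 fun i => (hp i).2)).trans hR
  rw [← image_univ, hinj.encard_image, encard_univ] at h1
  simp only [ENat.card_eq_coe_fintype_card, Fintype.card_fin] at h1
  norm_cast at h1
  omega

/-- A cluster point of a sequence in a topological graph is approached within small
connected pieces of the graph. -/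
theorem exists_isCompact_isPreconnected_frequently_mem {Y ι : Type*} [MetricSpace Y] [Finite ι]
    {γ : ι → Icc (0 : ℝ) 1 → Y} (hγ : ∀ i, Continuous (γ i)) {u : ℕ → Y}
    (hu : ∀ᶠ n in atTop, ∃ i, u n ∈ range (γ i)) {e : Y} (he : MapClusterPt e atTop u)
    {ε : ℝ} (hε : 0 < ε) :
    ∃ i, ∃ L ⊆ range (γ i), IsCompact L ∧ IsPreconnected L ∧ L ⊆ Metric.closedBall e ε ∧
      ∃ᶠ n in atTop, u n ∈ L := by
  obtain ⟨U, hU, hUe⟩ := mapClusterPt_iff_ultrafilter.1 he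
  obtain ⟨i, hi⟩ := U.eventually_exists_iff.1 (hU hu)
  have : ∃ t : ℕ → Icc (0 : ℝ) 1, ∀ᶠ n in U, γ i (t n) = u n := by
    classical
    refine ⟨fun n => if h : u n ∈ range (γ i) then h.choose else 0, hi.mono fun n hn => ?_⟩
    have hn' : u n ∈ range (γ i) := hn
    simp only [hn', dif_pos]
    exact hn'.choose_spec
  obtain ⟨t, ht⟩ := this
  obtain ⟨s, -, hs⟩ := isCompact_univ.ultrafilter_le_nhds (U.map t) (by simp)
  have hts : Tendsto t U (𝓝 s) := hs
  have hse : γ i s = e := by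
    refine tendsto_nhds_unique (((hγ i).tendsto s).comp hts) ?_
    exact hUe.congr' (ht.mono fun n hn => hn.symm)
  set g : ℝ → Y := fun x => γ i (projIcc 0 1 zero_le_one x) with hg
  have hgc : Continuous g := (hγ i).comp continuous_projIcc
  have hgs : g s = e := by simp [hg, hse]
  obtain ⟨δ, hδ, hδe⟩ := Metric.nhds_basis_closedBall.mem_iff.1
    (hgc.continuousAt.preimage_mem_nhds (hgs ▸ Metric.closedBall_mem_nhds e hε :
      Metric.closedBall e ε ∈ 𝓝 (g s)))
  refine ⟨i, g '' Metric.closedBall (s : ℝ) δ, ?_, (isCompact_closedBall _ _).image hgc, ?_,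
    image_subset_iff.2 hδe, ?_⟩
  · rintro _ ⟨x, -, rfl⟩
    exact mem_range_self _
  · rw [Real.closedBall_eq_Icc]
    exact isPreconnected_Icc.image _ hgc.continuousOn
  · have hev : ∀ᶠ n in U, u n ∈ g '' Metric.closedBall (s : ℝ) δ := by
      have hball : ∀ᶠ n in U, (t n : ℝ) ∈ Metric.closedBall (s : ℝ) δ :=
        ((continuous_subtype_val.tendsto s).comp hts).eventually
          (Metric.closedBall_mem_nhds _ hδ)
      filter_upwards [ht, hball] with n hn hn'
      exact ⟨t n, hn', by simp [hg, hn]⟩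
    exact hev.frequently.filter_mono hU

theorem IsTopGraph.exists_paths {Y : Type*} [TopologicalSpace Y] (hY : IsTopGraph Y) :
    ∃ (n : ℕ) (γ : Fin n → Icc (0 : ℝ) 1 → Y), (∀ i, Continuous (γ i)) ∧
      ∀ y, ∃ i, y ∈ range (γ i) := by
  obtain ⟨-, -, n, A, a, b, hA, hcov, -⟩ := hY
  choose φ hφc _ hφr _ _ using hA
  refine ⟨n, φ, hφc, fun y => ?_⟩
  obtain ⟨i, hi⟩ := mem_iUnion.1 (hcov ▸ mem_univ y : y ∈ ⋃ i, A i)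
  exact ⟨i, hφr i ▸ hi⟩

section OmegaSet

variable {Y : Type*} [TopologicalSpace Y] {f : Y → Y}

theorem isClosed_omegaSet (f : Y → Y) (x : Y) : IsClosed (omegaSet f x) :=
  isClosed_iInter fun _ => isClosed_closure

theorem mem_omegaSet_iff_mapClusterPt {x y : Y} :
    y ∈ omegaSet f x ↔ MapClusterPt y atTop (fun m => f^[m] x) := by
  simp only [omegaSet, mem_iInter, mapClusterPt_iff_frequently, mem_closure_iff_nhds,
    frequently_atTop]
  constructor
  · intro h s hs n
    obtain ⟨_, hms, m, hm, rfl⟩ := h n s hs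
    exact ⟨m, hm, hms⟩
  · intro h n s hs
    obtain ⟨m, hm, hms⟩ := h s hs n
    exact ⟨_, hms, m, hm, rfl⟩

theorem omegaSet_nonempty [CompactSpace Y] (f : Y → Y) (x : Y) : (omegaSet f x).Nonempty := by
  obtain ⟨y, -, hy⟩ := (isCompact_univ (X := Y)).exists_mapClusterPt
    (f := atTop) (u := fun m => f^[m] x) (by simp)
  exact ⟨y, mem_omegaSet_iff_mapClusterPt.2 hy⟩

theorem omegaSet_subset_of_eventually {S : Set Y} (hS : IsClosed S) {x : Y} {N : ℕ}
    (h : ∀ m ≥ N, f^[m] x ∈ S) : omegaSet f x ⊆ S :=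
  (iInter_subset _ N).trans (closure_minimal (by rintro _ ⟨m, hm, rfl⟩; exact h m hm) hS)

end OmegaSet

theorem iterate_mem_image_add {Y : Type*} {f : Y → Y} {K : Set Y} {i m : ℕ} {x : Y}
    (hx : x ∈ f^[i] '' K) :
    f^[m] x ∈ f^[m + i] '' K := by
  rw [Function.iterate_add, image_comp]
  exact mem_image_of_mem _ hx

section PeriodicSubgraph

variable {Y : Type*} [TopologicalSpace Y] {f : Y → Y} {K : Set Y} {k : ℕ}

theorem IsPeriodicSubgraph.image_iterate_mod (h : IsPeriodicSubgraph f K k) (i : ℕ) :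
    f^[i % k] '' K = f^[i] '' K := by
  have hmul : ∀ j, (f^[k * j]) '' K = K := by
    intro j
    induction j with
    | zero => simp
    | succ j ih => rw [Nat.mul_succ, Function.iterate_add, image_comp, h.2.2.1, ih]
  conv_rhs => rw [← Nat.mod_add_div i k, Function.iterate_add, image_comp, hmul]

theorem IsPeriodicSubgraph.image_iterate_congr (h : IsPeriodicSubgraph f K k) {i j : ℕ}
    (hij : i ≡ j [MOD k]) : f^[i] '' K = f^[j] '' K := by
  rw [← h.image_iterate_mod i, ← h.image_iterate_mod j, hij]

theorem IsPeriodicSubgraph.disjoint_of_not_modEq (h : IsPeriodicSubgraph f K k) {i j : ℕ}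
    (hij : ¬ i ≡ j [MOD k]) : Disjoint (f^[i] '' K) (f^[j] '' K) := by
  rw [← h.image_iterate_mod i, ← h.image_iterate_mod j]
  exact h.2.2.2 _ _ (Nat.mod_lt _ h.2.1) (Nat.mod_lt _ h.2.1) hij

theorem IsPeriodicSubgraph.iUnion_range_eq (h : IsPeriodicSubgraph f K k) :
    ⋃ i ∈ Finset.range k, f^[i] '' K = ⋃ i, f^[i] '' K := by
  refine Subset.antisymm (iUnion₂_subset fun i _ => subset_iUnion (fun i => f^[i] '' K) i)
    (iUnion_subset fun i => ?_)
  rw [← h.image_iterate_mod i]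
  exact subset_biUnion_of_mem (u := fun i => f^[i] '' K)
    (Finset.mem_range.2 (Nat.mod_lt i h.2.1))

theorem IsPeriodicSubgraph.isPreconnected_image (h : IsPeriodicSubgraph f K k)
    (hf : Continuous f) (i : ℕ) : IsPreconnected (f^[i] '' K) :=
  h.1.2.1.isPreconnected.image _ (hf.iterate i).continuousOn

theorem IsPeriodicSubgraph.isCompact_image [CompactSpace Y] (h : IsPeriodicSubgraph f K k)
    (hf : Continuous f) (i : ℕ) : IsCompact (f^[i] '' K) :=
  h.1.1.isCompact.image (hf.iterate i)

theorem IsPeriodicSubgraph.isClosed_iUnion [CompactSpace Y] [T2Space Y]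
    (h : IsPeriodicSubgraph f K k) (hf : Continuous f) : IsClosed (⋃ i, f^[i] '' K) := by
  rw [← h.iUnion_range_eq]
  exact (Finset.range k).finite_toSet.isClosed_biUnion fun i _ => (h.isCompact_image hf i).isClosed

end PeriodicSubgraph

section Solenoid

variable {G : Type*} [MetricSpace G] {f : G → G} {K : ℕ → Set G} {k : ℕ → ℕ}

/-- Every orbit accumulating at a point of `⋂ n, X n`, where the `X n` are cycles of graphs with
unbounded periods, enters each of these cycles. -/
theorem exists_iterate_mem_of_mem_omegaSet (hG : IsTopGraph G) (hf : Continuous f)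
    (hK : ∀ n, IsPeriodicSubgraph f (K n) (k n)) (hk : Tendsto k atTop atTop) {x y : G}
    (hy : y ∈ omegaSet f x) (hyQ : ∀ n, y ∈ ⋃ i, f^[i] '' K n) (n : ℕ) :
    ∃ a c, f^[a] x ∈ f^[c] '' K n := by
  by_contra! hx
  obtain ⟨R, hR⟩ := hG.exists_encard_frontier_le
  have hinj : Function.Injective fun j => f^[j] y := by
    have hlt : ∀ i j, i < j → f^[i] y ≠ f^[j] y := by
      intro i j hij heq
      obtain ⟨l, hl⟩ := (hk.eventually_gt_atTop j).exists
      obtain ⟨c, hc⟩ := mem_iUnion.1 (hyQ l)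
      refine disjoint_left.1 ((hK l).disjoint_of_not_modEq (i := i + c) (j := j + c) ?_)
        (iterate_mem_image_add hc) (heq ▸ iterate_mem_image_add hc)
      intro hmod
      have := Nat.ModEq.add_right_cancel' c hmod
      exact hij.ne (Nat.ModEq.eq_of_lt_of_lt this (hij.trans hl) hl)
    intro i j hij
    rcases lt_trichotomy i j with h | h | h
    · exact absurd hij (hlt i j h)
    · exact h
    · exact absurd hij.symm (hlt j i h)
  have hfin : (⋃ i ∈ Finset.range (k n), frontier (f^[i] '' K n)).Finite :=
    (Finset.range (k n)).finite_toSet.biUnion fun i _ =>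
      finite_of_encard_le_coe (hR _ ((hK n).isPreconnected_image hf i))
  refine infinite_range_of_injective hinj (hfin.subset ?_)
  rintro _ ⟨j, rfl⟩
  obtain ⟨c, hc⟩ := mem_iUnion.1 (hyQ n)
  have hmem : f^[j] y ∈ ⋃ i ∈ Finset.range (k n), f^[i] '' K n := by
    rw [(hK n).iUnion_range_eq]
    exact mem_iUnion.2 ⟨_, iterate_mem_image_add hc⟩
  obtain ⟨i, hi, hji⟩ := mem_iUnion₂.1 hmem
  refine mem_iUnion₂.2 ⟨i, hi, ?_⟩
  rw [frontier_eq_closure_inter_closure]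
  refine ⟨subset_closure hji, ?_⟩
  refine map_mem_closure (hf.iterate j) (mem_iInter.1 hy 0) ?_
  rintro _ ⟨m, -, rfl⟩
  show f^[j] (f^[m] x) ∉ _
  rw [← Function.iterate_add_apply]
  exact hx _ i

/-- `L` eventually covers every component of every sufficiently deep cycle. -/
def CoversComponents (f : G → G) (K : ℕ → Set G) (L : Set G) : Prop :=
  ∃ N, ∀ n ≥ N, ∀ d, ∃ m ≥ 1, f^[d] '' K n ⊆ f^[m] '' L

theorem coversComponents_of_frequently_mem (hG : IsTopGraph G) (hf : Continuous f)
    (hK : ∀ n, IsPeriodicSubgraph f (K n) (k n)) (hk : Tendsto k atTop atTop) {x : G}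
    (hx : ∀ n, ∃ a c, f^[a] x ∈ f^[c] '' K n) {L : Set G} (hL : IsPreconnected L)
    (hxL : ∃ᶠ b in atTop, f^[b] x ∈ L) : CoversComponents f K L := by
  obtain ⟨R, hR⟩ := hG.exists_encard_frontier_le
  obtain ⟨b, hb, hbL⟩ := extraction_of_frequently_atTop hxL
  obtain ⟨N, hN⟩ := eventually_atTop.1 (hk.eventually_gt_atTop (b R))
  refine ⟨N, fun n hn d => ?_⟩
  obtain ⟨a, c, hac⟩ := hx n
  have hmem : ∀ m, f^[m + a] x ∈ f^[m + c] '' K n := fun m => by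
    rw [Function.iterate_add_apply]
    exact iterate_mem_image_add hac
  have hlt : ∀ i : Fin (R + 1), b i < k n := fun i =>
    (hb.monotone (Nat.lt_succ_iff.1 i.2)).trans_lt (hN n hn)
  have hinj : ∀ i j : Fin (R + 1), b i + 1 + c ≡ b j + 1 + c [MOD k n] → i = j :=
    fun i j hmod => Fin.ext (hb.injective (Nat.ModEq.eq_of_lt_of_lt
      (Nat.ModEq.add_right_cancel' 1 (Nat.ModEq.add_right_cancel' c hmod)) (hlt i) (hlt j)))
  obtain ⟨i, hi⟩ := exists_subset_of_encard_frontier_le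
    (hR _ (hL.image _ (hf.iterate (a + 1)).continuousOn))
    (fun i : Fin (R + 1) => f^[b i + 1 + c] '' K n)
    (fun i => (hK n).isPreconnected_image hf _)
    (fun i j hij => (hK n).disjoint_of_not_modEq fun hmod => hij (hinj i j hmod))
    (fun i => ⟨f^[b i + 1 + a] x, hmem _, f^[b i] x, hbL i, by
      rw [← Function.iterate_add_apply]; congr 1; omega⟩)
  obtain ⟨j, hj⟩ : ∃ j, j + (b i + 1 + c) ≡ d [MOD k n] := by
    refine ⟨d + (k n - 1) * (b i + 1 + c), ?_⟩
    have hpos := (hK n).2.1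
    have : d + (k n - 1) * (b i + 1 + c) + (b i + 1 + c) = d + k n * (b i + 1 + c) := by
      obtain ⟨l, hl⟩ := Nat.exists_eq_succ_of_ne_zero hpos.ne'
      rw [hl, Nat.succ_sub_one, Nat.succ_eq_add_one]
      ring
    rw [this]
    simp [Nat.ModEq]
  refine ⟨j + (a + 1), by omega, ?_⟩
  rw [← (hK n).image_iterate_congr hj, Function.iterate_add _ j, image_comp,
    Function.iterate_add _ j, image_comp]
  exact image_mono hi

/-- Near every point of a solenoidal ω-limit set, each cycle contains small connected sets which
eventually cover the components of deep cycles. -/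
theorem exists_coversComponents_subset_closedBall (hG : IsTopGraph G) (hf : Continuous f)
    (hK : ∀ n, IsPeriodicSubgraph f (K n) (k n)) (hk : Tendsto k atTop atTop) {x e : G}
    (hx : ∀ n, ∃ a c, f^[a] x ∈ f^[c] '' K n) (he : e ∈ omegaSet f x) (n : ℕ)
    {ε : ℝ} (hε : 0 < ε) :
    ∃ L d, IsCompact L ∧ L.Nonempty ∧ CoversComponents f K L ∧ L ⊆ Metric.closedBall e ε ∧
      L ⊆ f^[d] '' K n := by
  obtain ⟨r, γ, hγ, hγK⟩ := (hK n).1.2.2.exists_paths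
  obtain ⟨a, c, hac⟩ := hx n
  have hpaths : ∀ᶠ b in atTop, ∃ p : Fin (k n) × Fin r,
      f^[b] x ∈ range fun t => f^[p.1] (γ p.2 t : G) := by
    refine eventually_atTop.2 ⟨a, fun b hb => ?_⟩
    have hmem : f^[b] x ∈ f^[b - a + c] '' K n := by
      have := iterate_mem_image_add (m := b - a) hac
      rwa [← Function.iterate_add_apply, Nat.sub_add_cancel hb] at this
    rw [← (hK n).image_iterate_mod] at hmem
    obtain ⟨y, hy, hyx⟩ := hmem
    obtain ⟨i, t, ht⟩ := hγK ⟨y, hy⟩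
    exact ⟨⟨⟨_, Nat.mod_lt _ (hK n).2.1⟩, i⟩, t, by simp only [ht]; exact hyx⟩
  obtain ⟨⟨d, i⟩, L, hLγ, hLc, hLp, hLe, hxL⟩ := exists_isCompact_isPreconnected_frequently_mem
    (γ := fun (p : Fin (k n) × Fin r) t => f^[p.1] (γ p.2 t))
    (fun p => (hf.iterate _).comp (continuous_subtype_val.comp (hγ _)))
    (u := fun b => f^[b] x) hpaths
    (mem_omegaSet_iff_mapClusterPt.1 he) hε
  obtain ⟨b, hbL⟩ := hxL.exists
  refine ⟨L, d, hLc, ⟨_, hbL⟩, coversComponents_of_frequently_mem hG hf hK hk hx hLp hxL, hLe,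
    hLγ.trans ?_⟩
  rintro _ ⟨t, rfl⟩
  exact ⟨_, (γ i t).2, rfl⟩

/-- A sequence of nonempty compact sets, each covered by an iterated image of the previous one,
is followed by some orbit. -/
theorem exists_forall_iterate_mem {Y : Type*} [TopologicalSpace Y] [T2Space Y] {f : Y → Y}
    (hf : Continuous f) {L : ℕ → Set Y} (hLc : ∀ i, IsCompact (L i)) (hLn : ∀ i, (L i).Nonempty)
    {M : ℕ → ℕ} (hM0 : M 0 = 0) {m : ℕ → ℕ} (hM : ∀ i, M (i + 1) = M i + m i)
    (hcov : ∀ i, L (i + 1) ⊆ f^[m i] '' L i) : ∃ z, ∀ i, f^[M i] z ∈ L i := by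
  let Z : ℕ → Set Y := fun i => ⋂ j ∈ Iic i, f^[M j] ⁻¹' L j
  have hsurj : ∀ i, ∀ w ∈ L i, ∃ z ∈ Z i, f^[M i] z = w := by
    intro i
    induction i with
    | zero =>
      intro w hw
      refine ⟨w, mem_iInter₂.2 fun j hj => ?_, by simp [hM0]⟩
      obtain rfl : j = 0 := Nat.le_zero.1 hj
      simpa [hM0] using hw
    | succ i ih =>
      intro w hw
      obtain ⟨v, hv, rfl⟩ := hcov i hw
      obtain ⟨z, hz, rfl⟩ := ih v hv
      have hzi : f^[M (i + 1)] z = f^[m i] (f^[M i] z) := by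
        rw [hM, add_comm, Function.iterate_add_apply]
      refine ⟨z, mem_iInter₂.2 fun j hj => ?_, hzi⟩
      rcases Nat.le_succ_iff.1 hj with h | rfl
      · exact mem_iInter₂.1 hz j h
      · rw [mem_preimage, hzi]
        exact hw
  have hZclosed : ∀ i, IsClosed (Z i) := fun i =>
    isClosed_biInter fun j _ => (hLc j).isClosed.preimage (hf.iterate _)
  have hZ0 : Z 0 ⊆ L 0 := fun z hz => by simpa [hM0] using mem_iInter₂.1 hz 0 (le_refl 0)
  obtain ⟨z, hz⟩ := IsCompact.nonempty_iInter_of_sequence_nonempty_isCompact_isClosed Z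
    (fun i => biInter_subset_biInter_left (Iic_subset_Iic.2 i.le_succ))
    (fun i => by
      obtain ⟨w, hw⟩ := hLn i
      obtain ⟨z, hz, -⟩ := hsurj i w hw
      exact ⟨z, hz⟩)
    ((hLc 0).of_isClosed_subset (hZclosed 0) hZ0) hZclosed
  exact ⟨z, fun i => mem_iInter₂.1 (mem_iInter.1 hz i) i (le_refl i)⟩

end Solenoid

/-- Given a nested sequence of cycles of graphs with periods tending to infinity,
there is a unique maximal ω-limit set in the intersection: there exists `z` with
`ω_f(z) ⊆ ⋂_n X_n` such that every ω-limit set meeting `⋂_n X_n` is contained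
in `ω_f(z)`. -/
theorem exists_maximal_omegaSet_in_iInter_cycles {G : Type*} [MetricSpace G]
    (hG : IsTopGraph G) (f : G → G) (hf : Continuous f)
    (X : ℕ → Set G) (k : ℕ → ℕ)
    (hX : ∀ n, IsCycleOfGraphs f (X n) (k n))
    (hnest : ∀ n, X (n + 1) ⊆ X n)
    (hk : Filter.Tendsto k Filter.atTop Filter.atTop) :
    ∃ z : G, omegaSet f z ⊆ (⋂ n, X n) ∧
      ∀ x : G, (omegaSet f x ∩ ⋂ n, X n).Nonempty → omegaSet f x ⊆ omegaSet f z := by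
  have : CompactSpace G := hG.1
  choose K hK hXK using hX
  replace hXK : ∀ n, X n = ⋃ i, f^[i] '' K n := fun n => (hXK n).trans (hK n).iUnion_range_eq
  have hanti : Antitone X := antitone_nat_of_succ_le hnest
  have hXclosed : ∀ n, IsClosed (X n) := fun n => hXK n ▸ (hK n).isClosed_iUnion hf
  have hXne : ∀ n, (X n).Nonempty := fun n => by
    obtain ⟨p, hp⟩ := (hK n).1.2.1.nonempty
    exact hXK n ▸ ⟨p, mem_iUnion.2 ⟨0, p, hp, rfl⟩⟩
  have hmaps : ∀ n x, x ∈ X n → ∀ m, f^[m] x ∈ X n := by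
    intro n x hx m
    rw [hXK] at hx ⊢
    obtain ⟨c, hc⟩ := mem_iUnion.1 hx
    exact mem_iUnion.2 ⟨_, iterate_mem_image_add hc⟩
  have homega : ∀ n x a, f^[a] x ∈ X n → omegaSet f x ⊆ X n := fun n x a hx =>
    omegaSet_subset_of_eventually (hXclosed n) (N := a) fun m hm => by
      rw [← Nat.sub_add_cancel hm, Function.iterate_add_apply]
      exact hmaps n _ hx _
  let S : Set G := {e | ∃ x, (omegaSet f x ∩ ⋂ n, X n).Nonempty ∧ e ∈ omegaSet f x}
  have hSne : S.Nonempty := by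
    obtain ⟨q, hq⟩ := IsCompact.nonempty_iInter_of_sequence_nonempty_isCompact_isClosed X hnest
      hXne (hXclosed 0).isCompact hXclosed
    obtain ⟨e, he⟩ := omegaSet_nonempty f q
    exact ⟨e, q, ⟨e, he, mem_iInter.2 fun n => homega n q 0 (mem_iInter.1 hq n) he⟩, he⟩
  have hlocal : ∀ e ∈ S, ∀ (n : ℕ) (ε : ℝ), 0 < ε → ∃ L d, IsCompact L ∧ L.Nonempty ∧
      CoversComponents f K L ∧ L ⊆ Metric.closedBall e ε ∧ L ⊆ f^[d] '' K n := by
    rintro e ⟨x, ⟨y, hy, hyQ⟩, he⟩ n ε hε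
    refine exists_coversComponents_subset_closedBall hG hf hK hk (fun n => ?_) he n hε
    exact exists_iterate_mem_of_mem_omegaSet hG hf hK hk hy
      (fun n => hXK n ▸ mem_iInter.1 hyQ n) n
  let P : Set G → Prop := fun L => IsCompact L ∧ L.Nonempty ∧ CoversComponents f K L
  have hstep : ∀ (L : {L // P L}) (e : S) (i : ℕ), ∃ (L' : {L // P L}) (m : ℕ), 1 ≤ m ∧
      L'.1 ⊆ f^[m] '' L.1 ∧ L'.1 ⊆ X i ∧ L'.1 ⊆ Metric.closedBall e.1 (1 / (i + 1)) := by
    rintro ⟨L, -, -, N, hN⟩ ⟨e, he⟩ i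
    obtain ⟨L', d, hc, hn, hP, hball, hsub⟩ :=
      hlocal e he (max N i) (1 / (i + 1)) Nat.one_div_pos_of_nat
    obtain ⟨m, hm, hcov⟩ := hN (max N i) (le_max_left _ _) d
    refine ⟨⟨L', hc, hn, hP⟩, m, hm, hsub.trans hcov, ?_, hball⟩
    refine (hsub.trans ?_).trans (hanti (le_max_right N i))
    rw [hXK]
    exact subset_iUnion (fun d => f^[d] '' K (max N i)) d
  choose next m hm hcov hsub hball using hstep
  have : Nonempty S := hSne.to_subtype
  let e : ℕ → S := TopologicalSpace.denseSeq S
  obtain ⟨L₀, -, hL₀c, hL₀n, hL₀, -, -⟩ := hlocal _ (e 0).2 0 1 one_pos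
  let L : ℕ → {L // P L} := fun i =>
    Nat.rec ⟨L₀, hL₀c, hL₀n, hL₀⟩ (fun i L => next L (e i.unpair.1) i) i
  let s : ℕ → ℕ := fun i => m (L i) (e i.unpair.1) i
  let M : ℕ → ℕ := fun i => ∑ j ∈ Finset.range i, s j
  obtain ⟨z, hz⟩ := exists_forall_iterate_mem hf (L := fun i => (L i).1) (fun i => (L i).2.1)
    (fun i => (L i).2.2.1) (M := M) (m := s) rfl (fun i => Finset.sum_range_succ _ _)
    (fun i => hcov (L i) (e i.unpair.1) i)
  have hMle : ∀ i, i ≤ M i := fun i => by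
    simpa using Finset.card_nsmul_le_sum (Finset.range i) s 1 fun j _ => hm _ _ _
  refine ⟨z, subset_iInter fun n => homega n z (M (n + 1)) ?_, ?_⟩
  · exact hsub (L n) (e n.unpair.1) n (hz (n + 1))
  · intro x hx w hw
    have hdense : ∀ j, (e j : G) ∈ omegaSet f z := by
      refine fun j => mem_iInter.2 fun N => Metric.mem_closure_iff.2 fun ε hε => ?_
      obtain ⟨l, hl⟩ := exists_nat_one_div_lt hε
      set i := Nat.pair j (max l N) with hi
      have hil : max l N ≤ i := Nat.right_le_pair _ _
      have hdist := hball (L i) (e i.unpair.1) i (hz (i + 1))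
      rw [hi, Nat.unpair_pair, ← hi, Metric.mem_closedBall, dist_comm] at hdist
      refine ⟨_, ⟨M (i + 1), ?_, rfl⟩, hdist.trans_lt (lt_of_le_of_lt ?_ hl)⟩
      · exact ((le_max_right l N).trans hil).trans (i.le_succ.trans (hMle _))
      · exact Nat.one_div_le_one_div ((le_max_left l N).trans hil)
    have hclosed : IsClosed ((↑) ⁻¹' omegaSet f z : Set S) :=
      (isClosed_omegaSet f z).preimage continuous_subtype_val
    have huniv := hclosed.closure_subset_iff.2 (range_subset_iff.2 hdense)
    exact huniv (TopologicalSpace.denseRange_denseSeq S ⟨w, x, hx, hw⟩)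
end
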